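/- Let p ≥ 5 be a prime. Then there exists a finite group P of order p^6 such that P has derived length exactly 3 (P'' ≠ 1 and P''' = 1), P has a normal subgroup G of index p which is an extraspecial p-group of order p^5 and exponent p^2, and cd(P) = {1, p, p^2}. -/

import Mathlib

/-- A finite group `G` is an extraspecial `p`-group if its center, derived subgroup
and Frattini subgroup all coincide and have order `p`. -/
def IsExtraspecial (p : ℕ) (G : Type*) [Group G] : Prop :=
  IsPGroup p G ∧ Subgroup.center G = commutator G ∧
    commutator G = frattini G ∧ Nat.card (Subgroup.center G) = p

/-- The set of character degrees of `G`: the dimensions of the simple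
finite-dimensional complex representations of `G`. -/
def charDegrees (G : Type) [Group G] : Set ℕ :=
  {d | ∃ V : FDRep ℂ G, CategoryTheory.Simple V ∧ Module.finrank ℂ V = d}

section Representations

open Module CategoryTheory

namespace Representation

variable {P V : Type*} [Group P] [AddCommGroup V] [Module ℂ V]

/-- An invariant subspace of an irreducible representation that contains a nonzero vector is
everything. -/
lemma IsIrreducible.eq_top_of_invariant {ρ : Representation ℂ P V} (hρ : ρ.IsIrreducible)
    (W : Submodule ℂ V) (hW : ∀ g, ∀ w ∈ W, ρ g w ∈ W) {v : V} (hv : v ≠ 0) (hvW : v ∈ W) :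
    W = ⊤ := by
  rcases hρ.eq_bot_or_eq_top ⟨W, fun g w hw => hW g w hw⟩ with h | h
  · have h' : W = ⊥ := congrArg Subrepresentation.toSubmodule h
    exact absurd (by simpa [h'] using hvW) hv
  · exact congrArg Subrepresentation.toSubmodule h

lemma IsIrreducible.nontrivial {ρ : Representation ℂ P V} (hρ : ρ.IsIrreducible) :
    Nontrivial V := by
  by_contra h
  rw [not_nontrivial_iff_subsingleton] at h
  exact hρ.toNontrivial.exists_pair_ne.elim fun a ⟨b, hab⟩ =>
    hab (Subrepresentation.toSubmodule_injective (Subsingleton.elim _ _))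

/-- If `ρ g` is not the identity, then `g` acts nontrivially on some irreducible representation
whose kernel contains that of `ρ`. -/
theorem exists_isIrreducible_apply_ne_one [Finite P] (g : P) (n : ℕ) :
    ∀ (V : Type) [AddCommGroup V] [Module ℂ V] [FiniteDimensional ℂ V]
      (ρ : Representation ℂ P V), finrank ℂ V = n → ρ g ≠ 1 →
      ∃ (U : Type) (_ : AddCommGroup U) (_ : Module ℂ U) (_ : FiniteDimensional ℂ U)
        (σ : Representation ℂ P U), σ.IsIrreducible ∧ σ g ≠ 1 ∧ ∀ h, ρ h = 1 → σ h = 1 := by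
  induction n using Nat.strong_induction_on with
  | _ n ih =>
  intro V _ _ _ ρ hn hg
  by_cases hirr : ρ.IsIrreducible
  · exact ⟨V, _, _, ‹_›, ρ, hirr, hg, fun _ h => h⟩
  have hnt : Nontrivial (Subrepresentation ρ) := by
    by_contra h
    rw [not_nontrivial_iff_subsingleton] at h
    apply hg
    ext v
    have hv : v ∈ (⊥ : Subrepresentation ρ) := by
      rw [Subsingleton.elim (⊥ : Subrepresentation ρ) ⊤]; trivial
    have hv : v = 0 := hv
    simp [hv]
  have hex : ∃ σ : Subrepresentation ρ, σ ≠ ⊥ ∧ σ ≠ ⊤ := by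
    by_contra! h
    exact hirr ⟨fun σ => or_iff_not_imp_left.2 (h σ)⟩
  obtain ⟨σ, hσb, hσt⟩ := hex
  have : NeZero (Nat.card P : ℂ) := ⟨by exact_mod_cast Nat.card_pos.ne'⟩
  have hss : ComplementedLattice (Subrepresentation ρ) :=
    inferInstanceAs (IsSemisimpleRepresentation ρ)
  obtain ⟨τ, hτ⟩ := hss.exists_isCompl σ
  have key : ∀ σ : Subrepresentation ρ, σ ≠ ⊤ → (∃ v ∈ σ, ρ g v ≠ v) →
      ∃ (U : Type) (_ : AddCommGroup U) (_ : Module ℂ U) (_ : FiniteDimensional ℂ U)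
        (σ : Representation ℂ P U), σ.IsIrreducible ∧ σ g ≠ 1 ∧ ∀ h, ρ h = 1 → σ h = 1 := by
    rintro σ hσt ⟨v, hv, hgv⟩
    have hlt : finrank ℂ σ.toSubmodule < n := by
      rw [← hn]
      exact Submodule.finrank_lt fun h => hσt (Subrepresentation.toSubmodule_injective h)
    obtain ⟨U, i₁, i₂, i₃, θ, h₁, h₂, h₃⟩ := ih _ hlt σ.toSubmodule σ.toRepresentation rfl
      (fun h => hgv (congrArg Subtype.val (LinearMap.congr_fun h ⟨v, hv⟩)))
    refine ⟨U, i₁, i₂, i₃, θ, h₁, h₂, fun h hh => h₃ h ?_⟩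
    ext w
    exact LinearMap.congr_fun hh w.1
  by_cases h₁ : ∃ v ∈ σ, ρ g v ≠ v
  · exact key σ hσt h₁
  by_cases h₂ : ∃ v ∈ τ, ρ g v ≠ v
  · refine key τ (fun h => hσb ?_) h₂
    have := hτ.disjoint
    rwa [h, disjoint_top] at this
  push Not at h₁ h₂
  exfalso
  apply hg
  ext v
  have hv : v ∈ σ.toSubmodule ⊔ τ.toSubmodule := by
    rw [← Subrepresentation.toSubmodule_sup, hτ.sup_eq_top]; trivial
  obtain ⟨a, ha, b, hb, rfl⟩ := Submodule.mem_sup.1 hv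
  simp [h₁ a ha, h₂ b hb]

/-- Joint eigenvectors of a family of endomorphisms are linearly independent if the corresponding
systems of eigenvalues are distinct. -/
lemma _root_.linearIndependent_of_joint_eigenvectors {ι κ : Type*} (f : κ → Module.End ℂ V)
    (w : ι → V) (χ : ι → κ → ℂ) (hf : ∀ i k, f k (w i) = χ i k • w i) (hw : ∀ i, w i ≠ 0)
    (hχ : Function.Injective χ) : LinearIndependent ℂ w := by
  classical
  rw [linearIndependent_iff']
  intro s
  induction s using Finset.induction_on with
  | empty => simp
  | insert i₀ s hi₀ ih =>
    intro g hg
    have hs : ∀ j ∈ s, g j = 0 := by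
      intro j hj
      obtain ⟨k, hk⟩ := Function.ne_iff.1 (hχ.ne (ne_of_mem_of_not_mem hj hi₀))
      have h₁ := congrArg (fun v => f k v - χ i₀ k • v) hg
      simp only [Finset.sum_insert hi₀, map_add, map_sum, map_smul, hf, smul_add, Finset.smul_sum,
        map_zero, smul_zero, sub_zero] at h₁
      have h₂ := ih (fun i => g i * (χ i k - χ i₀ k)) (by
        rw [← h₁, smul_comm (g i₀), add_sub_add_left_eq_sub, ← Finset.sum_sub_distrib]
        exact Finset.sum_congr rfl fun i _ => by module) j hj
      exact (mul_eq_zero.1 h₂).resolve_right (sub_ne_zero.2 hk)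
    rw [Finset.sum_insert hi₀, Finset.sum_eq_zero fun i hi => by rw [hs i hi, zero_smul],
      add_zero] at hg
    have h₀ := (smul_eq_zero.1 hg).resolve_right (hw i₀)
    simpa [h₀] using hs

/-- Let `v` be a common eigenvector, with eigenvalues `χ`, of a subgroup `S` in an irreducible
representation. If a normal subgroup `A ≤ S` is such that `χ` restricted to `A` is stabilized by no
element outside `S`, then the dimension is the index of `S`. -/
theorem IsIrreducible.finrank_eq_index [Finite P] [FiniteDimensional ℂ V]
    {ρ : Representation ℂ P V} (hρ : ρ.IsIrreducible) (A S : Subgroup P) [A.Normal] (hAS : A ≤ S)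
    (χ : P → ℂ) {v : V} (hv : v ≠ 0) (hχ : ∀ s ∈ S, ρ s v = χ s • v)
    (hst : ∀ g ∉ S, ∃ a ∈ A, χ (g⁻¹ * a * g) ≠ χ a) :
    finrank ℂ V = S.index := by
  set w : P ⧸ S → V := fun q => ρ q.out v with hw
  have hw0 : ∀ q, w q ≠ 0 := fun q h => hv (by
    have := congrArg (ρ q.out⁻¹) h
    simpa [hw, ← Module.End.mul_apply, ← map_mul] using this)
  have heig : ∀ q, ∀ a ∈ A, ρ a (w q) = χ (q.out⁻¹ * a * q.out) • w q := by
    intro q a ha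
    have hmem : q.out⁻¹ * a * q.out ∈ S := by
      simpa using hAS (‹A.Normal›.conj_mem a ha q.out⁻¹)
    have := congrArg (ρ q.out) (hχ _ hmem)
    simpa [hw, ← Module.End.mul_apply, ← map_mul, mul_assoc] using this
  have hli : LinearIndependent ℂ w := by
    refine linearIndependent_of_joint_eigenvectors (fun a : A => ρ a) w
      (fun q a => χ (q.out⁻¹ * a * q.out)) (fun q a => heig q a a.2) hw0 fun q r hqr => ?_
    by_contra hne
    obtain ⟨a, ha, hχa⟩ := hst (q.out⁻¹ * r.out) fun hmem => hne (by
      rw [← q.out_eq', ← r.out_eq']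
      exact QuotientGroup.eq.2 hmem)
    apply hχa
    have := congrFun hqr ⟨q.out * a * q.out⁻¹, ‹A.Normal›.conj_mem a ha _⟩
    simpa [mul_assoc] using this.symm
  have hspan : Submodule.span ℂ (Set.range w) = ⊤ := by
    have hmem : ∀ g, ρ g v ∈ Submodule.span ℂ (Set.range w) := by
      intro g
      obtain ⟨s, hs⟩ := QuotientGroup.mk_out_eq_mul S g
      have : ρ g v = χ (s : P)⁻¹ • w (g : P ⧸ S) := by
        simp only [hw]
        rw [← map_smul, ← hχ _ (S.inv_mem s.2), ← Module.End.mul_apply, ← map_mul, hs]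
        simp
      rw [this]
      exact Submodule.smul_mem _ _ (Submodule.subset_span ⟨_, rfl⟩)
    refine hρ.eq_top_of_invariant _ (fun g x hx => ?_) hv (by simpa using hmem 1)
    refine Submodule.span_induction (p := fun x _ => ρ g x ∈ Submodule.span ℂ (Set.range w))
      ?_ (by simp) (fun _ _ _ _ h₁ h₂ => by simpa using add_mem h₁ h₂)
      (fun c _ _ h => by simpa using Submodule.smul_mem _ c h) hx
    rintro _ ⟨q, rfl⟩
    simpa [hw, ← Module.End.mul_apply, ← map_mul] using hmem (g * q.out)
  have : Fintype (P ⧸ S) := Fintype.ofFinite _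
  rw [finrank_eq_card_basis (Basis.mk hli hspan.ge), Subgroup.index, Nat.card_eq_fintype_card]

end Representation

/-- Commuting endomorphisms of a nonzero complex vector space have a common eigenvector. -/
theorem Module.End.exists_common_eigenvector {ι : Type*} (n : ℕ) :
    ∀ (V : Type) [AddCommGroup V] [Module ℂ V] [FiniteDimensional ℂ V] [Nontrivial V]
      (f : ι → Module.End ℂ V), (∀ i j, Commute (f i) (f j)) → finrank ℂ V = n →
      ∃ v ≠ 0, ∃ χ : ι → ℂ, ∀ i, f i v = χ i • v := by
  induction n using Nat.strong_induction_on with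
  | _ n ih =>
  intro V _ _ _ _ f hf hn
  by_cases h : ∀ i, ∃ c : ℂ, ∀ v, f i v = c • v
  · obtain ⟨v, hv⟩ := exists_ne (0 : V)
    choose χ hχ using h
    exact ⟨v, hv, χ, fun i => hχ i v⟩
  push Not at h
  obtain ⟨i, hi⟩ := h
  obtain ⟨c, hc⟩ := Module.End.exists_eigenvalue (f i)
  obtain ⟨u, hu⟩ := hi c
  set W := (f i).eigenspace c
  have hW : ∀ j, ∀ w ∈ W, f j w ∈ W := fun j w hw => by
    rw [Module.End.mem_eigenspace_iff] at hw ⊢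
    rw [← Module.End.mul_apply, (hf i j).eq, Module.End.mul_apply, hw, map_smul]
  have hWt : W ≠ ⊤ := fun h => hu (Module.End.mem_eigenspace_iff.1 (by
    change u ∈ W
    rw [h]
    trivial))
  have : Nontrivial W := Submodule.nontrivial_iff_ne_bot.2 hc
  obtain ⟨v, hv, χ, hχ⟩ := ih _ (hn ▸ Submodule.finrank_lt hWt) W
    (fun j => (f j).restrict (hW j))
    (fun j k => by
      ext w
      exact LinearMap.congr_fun (hf j k).eq w.1) rfl
  exact ⟨v, fun h => hv (Subtype.ext h), χ, fun j => congrArg Subtype.val (hχ j)⟩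

namespace FDRep

variable {P : Type} [Group P]

lemma isIrreducible_of_simple (V : FDRep ℂ P) [Simple V] :
    Representation.IsIrreducible (V := V) V.ρ := by
  have hnt : ∃ v : V, v ≠ 0 := by
    by_contra! h
    apply Simple.not_isZero V
    rw [Limits.IsZero.iff_id_eq_zero]
    ext v
    exact h _
  obtain ⟨v, hv⟩ := hnt
  have : Nontrivial (Subrepresentation (W := V) V.ρ) :=
    ⟨⊥, ⊤, fun h => hv (by
      have hv : v ∈ (⊤ : Subrepresentation (W := V) V.ρ) := trivial
      rw [← h] at hv
      exact hv)⟩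
  refine ⟨fun σ => or_iff_not_imp_left.2 fun hσ => ?_⟩
  let ι : FDRep.of σ.toRepresentation ⟶ V :=
    ⟨FGModuleCat.ofHom σ.toSubmodule.subtype, fun g => by ext x; rfl⟩
  have hmono : Mono ι := by
    refine ⟨fun f g h => ?_⟩
    ext x
    have := congrArg (fun k => k.hom.hom.hom x) h
    exact this
  have hne : ι ≠ 0 := by
    intro h
    apply hσ
    refine SetLike.ext fun x => ⟨fun hx => ?_, fun hx => ?_⟩
    · exact congrArg (fun k => k.hom.hom.hom (⟨x, hx⟩ : σ.toSubmodule)) h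
    · have : x = 0 := hx
      rw [this]
      exact σ.toSubmodule.zero_mem
  have hiso : IsIso ι := isIso_of_mono_of_nonzero hne
  refine SetLike.ext fun x => ⟨fun _ => trivial, fun _ => ?_⟩
  have hx : ((inv ι) ≫ ι).hom.hom.hom x = x := by rw [IsIso.inv_hom_id]; rfl
  have hx' : ((inv ι).hom.hom.hom x : σ.toSubmodule).1 = x := hx
  rw [← hx']
  exact ((inv ι).hom.hom.hom x : σ.toSubmodule).2

lemma simple_of_isIrreducible [Finite P] {V : Type} [AddCommGroup V] [Module ℂ V]
    [FiniteDimensional ℂ V] (ρ : Representation ℂ P V) [ρ.IsIrreducible] :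
    Simple (FDRep.of ρ) := by
  have : NeZero (Nat.card P : ℂ) := ⟨by exact_mod_cast Nat.card_pos.ne'⟩
  rw [simple_iff_end_is_rank_one, ← Representation.IsIrreducible.finrank_intertwiningMap_self ρ]
  exact ((forget₂HomLinearEquiv (FDRep.of ρ) (FDRep.of ρ)).symm.trans
    (Rep.homLinearEquiv _ _)).finrank_eq

end FDRep

end Representations

/-- The set underlying the group of order `p ^ 6` constructed here: a central product of a cyclic
group of order `p ^ 2` with an extraspecial group, extended by a group of order `p`. -/
@[ext]
structure CubicExt (p : ℕ) where
  /-- the coordinate of the acting group of order `p` -/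
  t : ZMod p
  /-- the coordinate of order `p ^ 2` -/
  a : ZMod (p ^ 2)
  /-- the linear coordinate -/
  b : ZMod p
  /-- the quadratic coordinate -/
  c : ZMod p
  /-- the cubic coordinate -/
  d : ZMod p

namespace CubicExt

open scoped commutatorElement

variable {p : ℕ}

/-- Reduction modulo `p`. -/
def red : ZMod (p ^ 2) →+* ZMod p := ZMod.castHom (dvd_pow_self p two_ne_zero) _

/-- Multiplication by `p`, from `ZMod p` to `ZMod (p ^ 2)`. -/
def incl : ZMod p →+ ZMod (p ^ 2) :=
  ZMod.lift p ⟨AddMonoidHom.mulRight (p : ZMod (p ^ 2)) |>.comp (Int.castAddHom _), by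
    simp [← sq, ← Nat.cast_pow]⟩

lemma incl_intCast (n : ℤ) : incl (n : ZMod p) = n * p := by
  simp [incl]

lemma incl_natCast (n : ℕ) : incl (n : ZMod p) = n * p := by
  simpa using incl_intCast (p := p) n

@[simp]
lemma red_incl (x : ZMod p) : red (incl x) = 0 := by
  obtain ⟨n, rfl⟩ := ZMod.intCast_surjective x
  simp [incl_intCast]

section

variable [hp : Fact p.Prime]

lemma exists_incl_of_red_eq_zero {x : ZMod (p ^ 2)} (hx : red x = 0) : ∃ k, x = incl k := by
  obtain ⟨n, rfl⟩ := ZMod.intCast_surjective x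
  rw [map_intCast, ZMod.intCast_zmod_eq_zero_iff_dvd] at hx
  obtain ⟨m, rfl⟩ := hx
  exact ⟨m, by rw [incl_intCast]; push_cast; ring⟩

lemma incl_injective : Function.Injective (incl (p := p)) := by
  rw [injective_iff_map_eq_zero]
  intro x hx
  obtain ⟨n, rfl⟩ := ZMod.intCast_surjective x
  rw [incl_intCast] at hx
  have : ((n * p : ℤ) : ZMod (p ^ 2)) = 0 := by exact_mod_cast hx
  rw [ZMod.intCast_zmod_eq_zero_iff_dvd] at this
  rw [ZMod.intCast_zmod_eq_zero_iff_dvd]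
  have hp0 : (p : ℤ) ≠ 0 := by exact_mod_cast hp.out.ne_zero
  refine Int.dvd_of_mul_dvd_mul_right hp0 ?_
  simpa [sq] using this

end

/-- The image of the `b`-coordinate of `y` under the action of `t`. -/
def actB (t : ZMod p) (y : CubicExt p) : ZMod p := y.b + t * red y.a

/-- The image of the `c`-coordinate of `y` under the action of `t`. -/
def actC (t : ZMod p) (y : CubicExt p) : ZMod p := y.c + 2 * t * y.b + t ^ 2 * red y.a

/-- The image of the `d`-coordinate of `y` under the action of `t`. -/
def actD (t : ZMod p) (y : CubicExt p) : ZMod p :=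
  y.d + 3 * t * y.c + 3 * t ^ 2 * y.b + t ^ 3 * red y.a

/-- The alternating form of binary cubics, evaluated at `x` and the image of `y` under `x.t`. -/
def cocycle (x y : CubicExt p) : ZMod p :=
  red x.a * actD x.t y - x.d * red y.a - 3 * x.b * actC x.t y + 3 * x.c * actB x.t y

instance : Mul (CubicExt p) :=
  ⟨fun x y => ⟨x.t + y.t, x.a + y.a + incl (cocycle x y), x.b + actB x.t y, x.c + actC x.t y,
    x.d + actD x.t y⟩⟩

instance : One (CubicExt p) := ⟨⟨0, 0, 0, 0, 0⟩⟩

instance : Inv (CubicExt p) :=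
  ⟨fun x => ⟨-x.t, -x.a, -actB (-x.t) x, -actC (-x.t) x, -actD (-x.t) x⟩⟩

@[simp] lemma mul_t (x y : CubicExt p) : (x * y).t = x.t + y.t := rfl
@[simp] lemma mul_a (x y : CubicExt p) : (x * y).a = x.a + y.a + incl (cocycle x y) := rfl
@[simp] lemma mul_b (x y : CubicExt p) : (x * y).b = x.b + actB x.t y := rfl
@[simp] lemma mul_c (x y : CubicExt p) : (x * y).c = x.c + actC x.t y := rfl
@[simp] lemma mul_d (x y : CubicExt p) : (x * y).d = x.d + actD x.t y := rfl
@[simp] lemma one_t : (1 : CubicExt p).t = 0 := rfl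
@[simp] lemma one_a : (1 : CubicExt p).a = 0 := rfl
@[simp] lemma one_b : (1 : CubicExt p).b = 0 := rfl
@[simp] lemma one_c : (1 : CubicExt p).c = 0 := rfl
@[simp] lemma one_d : (1 : CubicExt p).d = 0 := rfl
@[simp] lemma inv_t (x : CubicExt p) : x⁻¹.t = -x.t := rfl
@[simp] lemma inv_a (x : CubicExt p) : x⁻¹.a = -x.a := rfl
@[simp] lemma inv_b (x : CubicExt p) : x⁻¹.b = -actB (-x.t) x := rfl
@[simp] lemma inv_c (x : CubicExt p) : x⁻¹.c = -actC (-x.t) x := rfl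
@[simp] lemma inv_d (x : CubicExt p) : x⁻¹.d = -actD (-x.t) x := rfl

lemma cocycle_add (x y z : CubicExt p) :
    cocycle x y + cocycle (x * y) z = cocycle y z + cocycle x (y * z) := by
  simp [cocycle, actB, actC, actD]
  ring

instance : Group (CubicExt p) := Group.ofLeftAxioms
  (fun x y z => by
    have h : incl (cocycle x y) + incl (cocycle (x * y) z) =
        incl (cocycle y z) + incl (cocycle x (y * z)) := by
      rw [← map_add, ← map_add, cocycle_add]
    ext
    · simp [add_assoc]
    · simp only [mul_a]
      linear_combination h
    all_goals simp [actB, actC, actD]; ring)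
  (fun x => by ext <;> simp [cocycle, actB, actC, actD])
  (fun x => by
    ext
    · simp
    · have h : cocycle x⁻¹ x = 0 := by
        simp [cocycle, actB, actC, actD]
        ring
      simp [h]
    all_goals
      simp [actB, actC, actD]
      try ring)

/-- The underlying set as a product. -/
def equivProd (p : ℕ) :
    CubicExt p ≃ ZMod p × ZMod (p ^ 2) × ZMod p × ZMod p × ZMod p where
  toFun x := (x.t, x.a, x.b, x.c, x.d)
  invFun x := ⟨x.1, x.2.1, x.2.2.1, x.2.2.2.1, x.2.2.2.2⟩

lemma card_eq : Nat.card (CubicExt p) = p ^ 6 := by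
  rw [Nat.card_congr (equivProd p)]
  simp [Nat.card_prod]
  ring

instance [hp : Fact p.Prime] : Finite (CubicExt p) :=
  Nat.finite_of_card_ne_zero (by rw [card_eq]; exact pow_ne_zero _ hp.out.ne_zero)

/-- The projection to the acting group of order `p`. -/
def tHom (p : ℕ) : CubicExt p →* Multiplicative (ZMod p) where
  toFun x := .ofAdd x.t
  map_one' := rfl
  map_mul' _ _ := rfl

/-- The extraspecial subgroup of index `p`. -/
def extra (p : ℕ) : Subgroup (CubicExt p) := (tHom p).ker

instance : (extra p).Normal := inferInstanceAs (tHom p).ker.Normal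

lemma mem_extra {x : CubicExt p} : x ∈ extra p ↔ x.t = 0 := Iff.rfl

/-- The central subgroup of order `p`. -/
def central (p : ℕ) : Subgroup (CubicExt p) where
  carrier := {x | x.t = 0 ∧ red x.a = 0 ∧ x.b = 0 ∧ x.c = 0 ∧ x.d = 0}
  one_mem' := by simp
  mul_mem' := by
    rintro x y ⟨h₁, h₂, h₃, h₄, h₅⟩ ⟨k₁, k₂, k₃, k₄, k₅⟩
    simp [*, actB, actC, actD]
  inv_mem' := by
    rintro x ⟨h₁, h₂, h₃, h₄, h₅⟩
    simp [*, actB, actC, actD]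

lemma mem_central {x : CubicExt p} :
    x ∈ central p ↔ x.t = 0 ∧ red x.a = 0 ∧ x.b = 0 ∧ x.c = 0 ∧ x.d = 0 := Iff.rfl

/-- The elements of the central subgroup of order `p`. -/
def cen (k : ZMod p) : CubicExt p := ⟨0, incl k, 0, 0, 0⟩

lemma cen_mem_central (k : ZMod p) : cen k ∈ central p := by simp [mem_central, cen]

lemma cen_mul (k : ZMod p) (x : CubicExt p) : cen k * x = ⟨x.t, incl k + x.a, x.b, x.c, x.d⟩ := by
  ext <;> simp [cen, cocycle, actB, actC, actD]

lemma cen_comm (k : ZMod p) (x : CubicExt p) : cen k * x = x * cen k := by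
  ext <;> simp [cen, cocycle, actB, actC, actD, add_comm]

lemma exists_cen_of_mem_central [Fact p.Prime] {x : CubicExt p} (hx : x ∈ central p) :
    ∃ k, x = cen k := by
  obtain ⟨h₁, h₂, h₃, h₄, h₅⟩ := hx
  obtain ⟨k, hk⟩ := exists_incl_of_red_eq_zero h₂
  exact ⟨k, by ext <;> simp [cen, *]⟩

lemma cen_injective [Fact p.Prime] : Function.Injective (cen (p := p)) := fun _ _ h =>
  incl_injective (congrArg CubicExt.a h)

/-- Elements of the extraspecial subgroup commute up to the alternating form. -/
lemma mul_eq_cen_mul {x y : CubicExt p} (hx : x ∈ extra p) (hy : y ∈ extra p) :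
    x * y = cen (2 * (red x.a * y.d - x.d * red y.a - 3 * x.b * y.c + 3 * x.c * y.b)) *
      (y * x) := by
  rw [mem_extra] at hx hy
  rw [cen_mul]
  ext
  · simp [hx, hy]
  · have h : cocycle x y =
        2 * (red x.a * y.d - x.d * red y.a - 3 * x.b * y.c + 3 * x.c * y.b) + cocycle y x := by
      simp [cocycle, actB, actC, actD, hx, hy]
      ring
    simp only [mul_a, h, map_add]
    ring
  all_goals simp [hx, hy, actB, actC, actD, add_comm]

lemma commutatorElement_eq_cen {x y : CubicExt p} (hx : x ∈ extra p) (hy : y ∈ extra p) :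
    ⁅x, y⁆ = cen (2 * (red x.a * y.d - x.d * red y.a - 3 * x.b * y.c + 3 * x.c * y.b)) := by
  rw [commutatorElement_def, mul_inv_eq_iff_eq_mul, mul_inv_eq_iff_eq_mul, mul_assoc,
    mul_eq_cen_mul hx hy]

lemma pow_of_mem_extra {x : CubicExt p} (hx : x ∈ extra p) (n : ℕ) :
    x ^ n = ⟨0, n * x.a, n * x.b, n * x.c, n * x.d⟩ := by
  rw [mem_extra] at hx
  induction n with
  | zero => ext <;> simp
  | succ n ih =>
    rw [pow_succ, ih]
    ext
    · simp [hx]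
    · have h : cocycle ⟨0, (n : ZMod (p ^ 2)) * x.a, (n : ZMod p) * x.b, (n : ZMod p) * x.c,
          (n : ZMod p) * x.d⟩ x = 0 := by
        simp [cocycle, actB, actC, actD]
        ring
      simp only [mul_a, h, map_zero]
      push_cast
      ring
    all_goals simp [actB, actC, actD]; ring

lemma cen_natCast (n : ℕ) : cen (n : ZMod p) = cen 1 ^ n := by
  rw [pow_of_mem_extra (by simp [mem_extra, cen])]
  have := incl_natCast (p := p) 1
  ext <;> simp_all [cen, incl_natCast]

lemma mk_t_pow (n : ℕ) : (⟨1, 0, 0, 0, 0⟩ : CubicExt p) ^ n = ⟨n, 0, 0, 0, 0⟩ := by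
  induction n with
  | zero => ext <;> simp
  | succ n ih =>
    rw [pow_succ, ih]
    ext <;> simp [cocycle, actB, actC, actD]

lemma eq_mul_mk_t (x : CubicExt p) : x = ⟨0, x.a, x.b, x.c, x.d⟩ * ⟨x.t, 0, 0, 0, 0⟩ := by
  ext <;> simp [cocycle, actB, actC, actD]

end CubicExt

open scoped commutatorElement

lemma Subgroup.isCoatom_of_index_prime {G : Type*} [Group G] {H : Subgroup G}
    (hH : H.index.Prime) : IsCoatom H := by
  refine ⟨fun h => hH.ne_one (Subgroup.index_eq_one.2 h), fun K hK => ?_⟩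
  have hmul := Subgroup.relIndex_mul_index hK.le
  rcases (Nat.dvd_prime hH).1 (Dvd.intro_left _ hmul) with h | h
  · exact Subgroup.index_eq_one.1 h
  · rw [h] at hmul
    have := Nat.eq_of_mul_eq_mul_right hH.pos (hmul.trans (one_mul _).symm)
    exact absurd (Subgroup.relIndex_eq_one.1 this) hK.not_ge

/-- Central elements of the derived subgroup lie in the Frattini subgroup. -/
lemma center_inf_commutator_le_frattini (G : Type*) [Group G] :
    Subgroup.center G ⊓ commutator G ≤ frattini G := by
  simp only [frattini, Order.radical, le_iInf_iff]
  intro M hM z hz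
  by_contra hzM
  have htop : M ⊔ Subgroup.center G = ⊤ :=
    hM.2 _ (left_lt_sup.2 fun h => hzM (h hz.1))
  suffices h : commutator G ≤ M from hzM (h hz.2)
  rw [commutator_def, Subgroup.commutator_le]
  intro x _ y _
  obtain ⟨m, hm, u, hu, rfl⟩ := Subgroup.mem_sup_of_normal_right.1 (htop ▸ Subgroup.mem_top x)
  obtain ⟨n, hn, w, hw, rfl⟩ := Subgroup.mem_sup_of_normal_right.1 (htop ▸ Subgroup.mem_top y)
  rw [Subgroup.mem_center_iff] at hu hw
  have h : ⁅m * u, n * w⁆ = m * n * m⁻¹ * n⁻¹ := by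
    rw [commutatorElement_def, mul_inv_eq_iff_eq_mul, mul_inv_eq_iff_eq_mul]
    calc m * u * (n * w) = m * (n * u) * w := by rw [hu n]; group
      _ = m * n * (w * u) := by rw [mul_assoc _ _ w, mul_assoc n, ← hw u, ← mul_assoc]
      _ = m * n * m⁻¹ * (m * w) * u := by group
      _ = m * n * m⁻¹ * n⁻¹ * (n * w) * (m * u) := by rw [hw m]; group
  rw [h]
  exact M.mul_mem (M.mul_mem (M.mul_mem hm hn) (M.inv_mem hm)) (M.inv_mem hn)

namespace CubicExt

variable {p : ℕ} [hp : Fact p.Prime]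

lemma index_extra : (extra p).index = p := by
  rw [extra, Subgroup.index_ker, MonoidHom.range_eq_top.2 fun t => ⟨⟨t.toAdd, 0, 0, 0, 0⟩, rfl⟩,
    Subgroup.card_top]
  exact (Nat.card_congr Multiplicative.toAdd).trans (Nat.card_zmod p)

lemma card_extra : Nat.card (extra p) = p ^ 5 := by
  have h := (extra p).card_mul_index
  rw [index_extra, card_eq] at h
  exact Nat.eq_of_mul_eq_mul_right hp.out.pos (h.trans (pow_succ p 5))

lemma two_ne_zero_zmod (hp5 : 5 ≤ p) : (2 : ZMod p) ≠ 0 := fun h => by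
  have := (ZMod.natCast_eq_zero_iff 2 p).1 (by exact_mod_cast h)
  exact absurd (Nat.le_of_dvd (by norm_num) this) (by omega)

lemma three_ne_zero_zmod (hp5 : 5 ≤ p) : (3 : ZMod p) ≠ 0 := fun h => by
  have := (ZMod.natCast_eq_zero_iff 3 p).1 (by exact_mod_cast h)
  exact absurd (Nat.le_of_dvd (by norm_num) this) (by omega)

lemma derivedSeries_one_le : derivedSeries (CubicExt p) 1 ≤ extra p := by
  rw [derivedSeries_succ, derivedSeries_zero, Subgroup.commutator_le]
  intro x _ y _
  simp [mem_extra, commutatorElement_def]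

lemma derivedSeries_two_le : derivedSeries (CubicExt p) 2 ≤ central p := by
  rw [derivedSeries_succ, Subgroup.commutator_le]
  intro x hx y hy
  rw [commutatorElement_eq_cen (derivedSeries_one_le hx) (derivedSeries_one_le hy)]
  exact cen_mem_central _

lemma derivedSeries_three : derivedSeries (CubicExt p) 3 = ⊥ := by
  rw [derivedSeries_succ, eq_bot_iff, Subgroup.commutator_le]
  intro x hx y hy
  obtain ⟨k, rfl⟩ := exists_cen_of_mem_central (derivedSeries_two_le hx)
  rw [Subgroup.mem_bot, commutatorElement_eq_one_iff_mul_comm, cen_comm]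

lemma derivedSeries_two_ne_bot (hp5 : 5 ≤ p) : derivedSeries (CubicExt p) 2 ≠ ⊥ := by
  intro h
  have hmem : ∀ x y : CubicExt p, ⁅x, y⁆ ∈ derivedSeries (CubicExt p) 1 := fun x y =>
    Subgroup.commutator_mem_commutator (Subgroup.mem_top x) (Subgroup.mem_top y)
  set x : CubicExt p := ⁅(⟨1, 0, 0, 0, 0⟩ : CubicExt p), ⟨0, 1, 0, 0, 0⟩⁆
  set y : CubicExt p := ⁅(⟨1, 0, 0, 0, 0⟩ : CubicExt p), ⟨0, 0, 1, 0, 0⟩⁆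
  have hxy : ⁅x, y⁆ ∈ derivedSeries (CubicExt p) 2 := by
    rw [derivedSeries_succ]
    exact Subgroup.commutator_mem_commutator (hmem _ _) (hmem _ _)
  rw [h, Subgroup.mem_bot, commutatorElement_eq_cen (derivedSeries_one_le (hmem _ _))
    (derivedSeries_one_le (hmem _ _))] at hxy
  have h0 := cen_injective (hxy.trans (by ext <;> simp [cen] : (1 : CubicExt p) = cen 0))
  have hxa : red x.a = 0 := by simp [x, commutatorElement_def]
  have hxb : x.b = 1 := by simp [x, commutatorElement_def, actB]
  have hya : red y.a = 0 := by simp [y, commutatorElement_def]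
  have hyb : y.b = 0 := by simp [y, commutatorElement_def, actB]
  have hyc : y.c = 2 := by simp [y, commutatorElement_def, actB, actC]
  rw [hxa, hxb, hya, hyb, hyc] at h0
  have h12 : (2 : ZMod p) * 2 * 3 = 0 := by linear_combination -h0
  simp [two_ne_zero_zmod hp5, three_ne_zero_zmod hp5] at h12

/-- The centre of the extraspecial subgroup, as a subgroup of it. -/
lemma mem_center_extra (hp5 : 5 ≤ p) {x : extra p} :
    x ∈ Subgroup.center (extra p) ↔ x.1 ∈ central p := by
  have h2 := two_ne_zero_zmod hp5
  have h3 := three_ne_zero_zmod hp5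
  rw [Subgroup.mem_center_iff]
  constructor
  · intro h
    have key : ∀ y : CubicExt p, y ∈ extra p →
        red x.1.a * y.d - x.1.d * red y.a - 3 * x.1.b * y.c + 3 * x.1.c * y.b = 0 := by
      intro y hy
      have h₁ : ⁅x.1, y⁆ = 1 := commutatorElement_eq_one_iff_mul_comm.2
        (congrArg Subtype.val (h ⟨y, hy⟩)).symm
      rw [commutatorElement_eq_cen x.2 hy] at h₁
      have h₀ := cen_injective (h₁.trans (by ext <;> simp [cen] : (1 : CubicExt p) = cen 0))
      simpa [h2] using h₀
    refine ⟨x.2, ?_, ?_, ?_, ?_⟩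
    · simpa using key ⟨0, 0, 0, 0, 1⟩ rfl
    · simpa [h3] using key ⟨0, 0, 0, 1, 0⟩ rfl
    · simpa [h3] using key ⟨0, 0, 1, 0, 0⟩ rfl
    · simpa using key ⟨0, 1, 0, 0, 0⟩ rfl
  · intro hx y
    obtain ⟨k, hk⟩ := exists_cen_of_mem_central hx
    apply Subtype.ext
    change y.1 * x.1 = x.1 * y.1
    rw [hk, cen_comm]

lemma commutator_extra (hp5 : 5 ≤ p) : commutator (extra p) = Subgroup.center (extra p) := by
  apply le_antisymm
  · rw [commutator_def, Subgroup.commutator_le]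
    intro x _ y _
    rw [mem_center_extra hp5]
    change ⁅x.1, y.1⁆ ∈ central p
    rw [commutatorElement_eq_cen x.2 y.2]
    exact cen_mem_central _
  · intro x hx
    obtain ⟨k, hk⟩ := exists_cen_of_mem_central ((mem_center_extra hp5).1 hx)
    have : x = ⁅(⟨⟨0, 1, 0, 0, 0⟩, rfl⟩ : extra p), ⟨⟨0, 0, 0, 0, k / 2⟩, rfl⟩⁆ := by
      apply Subtype.ext
      change x.1 = ⁅(⟨0, 1, 0, 0, 0⟩ : CubicExt p), ⟨0, 0, 0, 0, k / 2⟩⁆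
      rw [hk, commutatorElement_eq_cen rfl rfl]
      simp [mul_div_cancel₀ _ (two_ne_zero_zmod hp5)]
    rw [this]
    exact Subgroup.commutator_mem_commutator (Subgroup.mem_top _) (Subgroup.mem_top _)

/-- A homomorphism onto a group of order `p` kills the Frattini subgroup. -/
lemma frattini_le_ker {G : Type*} [Group G] (f : G →* Multiplicative (ZMod p))
    (hf : Function.Surjective f) : frattini G ≤ f.ker := by
  apply frattini_le_coatom
  apply Subgroup.isCoatom_of_index_prime
  rw [Subgroup.index_ker, MonoidHom.range_eq_top.2 hf]
  simpa using hp.out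

/-- A coordinate of the extraspecial subgroup that is additive, as a homomorphism. -/
def coordHom (f : CubicExt p → ZMod p) (h₁ : f 1 = 0)
    (hmul : ∀ x y : CubicExt p, x.t = 0 → y.t = 0 → f (x * y) = f x + f y) :
    extra p →* Multiplicative (ZMod p) where
  toFun x := .ofAdd (f x.1)
  map_one' := by simp [h₁]
  map_mul' x y := by simp [hmul x.1 y.1 x.2 y.2]

lemma frattini_extra (hp5 : 5 ≤ p) : frattini (extra p) = commutator (extra p) := by
  apply le_antisymm
  · intro x hx
    rw [commutator_extra hp5, mem_center_extra hp5]
    have key : ∀ (f : CubicExt p → ZMod p) (h₁ : f 1 = 0)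
        (hmul : ∀ x y : CubicExt p, x.t = 0 → y.t = 0 → f (x * y) = f x + f y),
        (∀ k : ZMod p, ∃ y ∈ extra p, f y = k) → f x.1 = 0 := by
      intro f h₁ hmul hsurj
      exact frattini_le_ker (coordHom f h₁ hmul)
        (fun k => (hsurj k.toAdd).elim fun y hy => ⟨⟨y, hy.1⟩, hy.2⟩) hx
    refine ⟨x.2, key (fun x => red x.a) (by simp) (by simp) fun k => ?_,
      key (fun x => x.b) rfl (fun x y hx hy => by simp [actB, hx])
        fun k => ⟨⟨0, 0, k, 0, 0⟩, rfl, rfl⟩,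
      key (fun x => x.c) rfl (fun x y hx hy => by simp [actC, hx])
        fun k => ⟨⟨0, 0, 0, k, 0⟩, rfl, rfl⟩,
      key (fun x => x.d) rfl (fun x y hx hy => by simp [actD, hx])
        fun k => ⟨⟨0, 0, 0, 0, k⟩, rfl, rfl⟩⟩
    obtain ⟨n, rfl⟩ := ZMod.natCast_zmod_surjective k
    exact ⟨⟨0, n, 0, 0, 0⟩, rfl, by simp⟩
  · have h := center_inf_commutator_le_frattini (extra p)
    rwa [commutator_extra hp5, inf_idem, ← commutator_extra hp5] at h

lemma isExtraspecial_extra (hp5 : 5 ≤ p) : IsExtraspecial p (extra p) := by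
  refine ⟨IsPGroup.of_card card_extra, (commutator_extra hp5).symm, (frattini_extra hp5).symm, ?_⟩
  have hbij : Function.Bijective (fun k : ZMod p =>
      (⟨⟨cen k, rfl⟩, (mem_center_extra hp5).2 (cen_mem_central k)⟩ :
        Subgroup.center (extra p))) := by
    constructor
    · intro k l h
      exact cen_injective (congrArg (fun x => x.1.1) h)
    · intro x
      obtain ⟨k, hk⟩ := exists_cen_of_mem_central ((mem_center_extra hp5).1 x.2)
      exact ⟨k, Subtype.ext (Subtype.ext hk.symm)⟩
  rw [← Nat.card_congr (Equiv.ofBijective _ hbij), Nat.card_zmod]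

lemma pow_sq_eq_one {g : CubicExt p} (hg : g ∈ extra p) : g ^ p ^ 2 = 1 := by
  rw [pow_of_mem_extra hg]
  ext <;> simp

lemma exists_orderOf_eq_sq : ∃ g ∈ extra p, orderOf g = p ^ 2 := by
  refine ⟨⟨0, 1, 0, 0, 0⟩, rfl, ?_⟩
  refine orderOf_eq_prime_pow (n := 1) (p := p) (fun h => ?_) (pow_sq_eq_one rfl)
  rw [pow_of_mem_extra rfl, pow_one] at h
  have h₀ : ((p : ℕ) : ZMod (p ^ 2)) = 0 := by simpa using congrArg CubicExt.a h
  rw [ZMod.natCast_eq_zero_iff] at h₀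
  have := Nat.le_of_dvd hp.out.pos h₀
  nlinarith [hp.out.two_le]

end CubicExt

section Weights

open Module

/-- If `X` and `Y` commute up to a nontrivial `p`-th root of unity and `X ^ p = 1`, then `X` fixes
a nonzero vector in each nonzero subspace invariant under both. -/
lemma exists_fixed_of_commute_up_to_root {V : Type*} [AddCommGroup V] [Module ℂ V]
    [FiniteDimensional ℂ V] {p : ℕ} (hp : p.Prime) (X Y : Module.End ℂ V) (ζ : ℂ)
    (hζ : ζ ^ p = 1) (hζ1 : ζ ≠ 1) (hXY : X * Y = ζ • (Y * X)) (hX : X ^ p = 1)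
    (hY : Function.Injective Y) (W : Submodule ℂ V) (hW : W ≠ ⊥) (hXW : ∀ w ∈ W, X w ∈ W)
    (hYW : ∀ w ∈ W, Y w ∈ W) : ∃ w ∈ W, w ≠ 0 ∧ X w = w := by
  have : Fact p.Prime := ⟨hp⟩
  have hprim : IsPrimitiveRoot ζ p := by
    rw [← orderOf_eq_prime hζ hζ1]
    exact IsPrimitiveRoot.orderOf ζ
  have : Nontrivial W := Submodule.nontrivial_iff_ne_bot.2 hW
  obtain ⟨l, hl⟩ := Module.End.exists_eigenvalue (X.restrict hXW)
  obtain ⟨u, hu⟩ := hl.exists_hasEigenvector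
  have hu0 : u.1 ≠ 0 := fun h => hu.2 (Subtype.ext h)
  have hXu : X u.1 = l • u.1 := congrArg Subtype.val hu.apply_eq_smul
  have hXpow : ∀ n : ℕ, (X ^ n) u.1 = l ^ n • u.1 := by
    intro n
    induction n with
    | zero => simp
    | succ n ih => rw [pow_succ', Module.End.mul_apply, ih, map_smul, hXu, smul_smul, pow_succ]
  have hlp : l ^ p = 1 := by
    have h := hXpow p
    rw [hX, Module.End.one_apply] at h
    have : (l ^ p - 1) • u.1 = 0 := by rw [sub_smul, one_smul, ← h, sub_self]
    exact sub_eq_zero.1 ((smul_eq_zero.1 this).resolve_right hu0)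
  have hl0 : l ≠ 0 := fun h => by simp [h, hp.ne_zero] at hlp
  obtain ⟨k, -, hk⟩ := hprim.eq_pow_of_pow_eq_one (ξ := l⁻¹) (by rw [inv_pow, hlp, inv_one])
  have hY' : ∀ n : ℕ, (Y ^ n) u.1 ∈ W ∧ (Y ^ n) u.1 ≠ 0 ∧
      X ((Y ^ n) u.1) = (ζ ^ n * l) • (Y ^ n) u.1 := by
    intro n
    induction n with
    | zero => exact ⟨u.2, hu0, by simpa using hXu⟩
    | succ n ih =>
      rw [pow_succ', Module.End.mul_apply]
      refine ⟨hYW _ ih.1, fun h => ih.2.1 (hY (h.trans (map_zero Y).symm)), ?_⟩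
      rw [← Module.End.mul_apply X Y, hXY, LinearMap.smul_apply, Module.End.mul_apply, ih.2.2,
        map_smul, smul_smul, pow_succ']
      ring_nf
  refine ⟨_, (hY' k).1, (hY' k).2.1, ?_⟩
  rw [(hY' k).2.2, hk, inv_mul_cancel₀ hl0, one_smul]

end Weights

namespace CubicExt

open Module

variable {p : ℕ} [hp : Fact p.Prime]

/-- The abelian normal subgroup of order `p ^ 3`. -/
def abel (p : ℕ) : Subgroup (CubicExt p) where
  carrier := {x | x.t = 0 ∧ red x.a = 0 ∧ x.b = 0}
  one_mem' := by simp
  mul_mem' := by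
    rintro x y ⟨h₁, h₂, h₃⟩ ⟨k₁, k₂, k₃⟩
    simp [*, actB]
  inv_mem' := by
    rintro x ⟨h₁, h₂, h₃⟩
    simp [*, actB]

instance : (abel p).Normal where
  conj_mem := by
    rintro x ⟨h₁, h₂, h₃⟩ g
    refine ⟨by simp [h₁], by simp [h₂], ?_⟩
    simp [h₁, h₂, h₃, actB]

/-- A subgroup of index `p ^ 2` containing `abel p`. -/
def inertia (p : ℕ) : Subgroup (CubicExt p) where
  carrier := {x | red x.a = 0 ∧ x.b = 0}
  one_mem' := by simp
  mul_mem' := by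
    rintro x y ⟨h₂, h₃⟩ ⟨k₂, k₃⟩
    simp [*, actB]
  inv_mem' := by
    rintro x ⟨h₂, h₃⟩
    simp [*, actB]

lemma index_inertia : (inertia p).index = p ^ 2 := by
  have hbij : Function.Bijective (fun x : ZMod p × ZMod p × ZMod p × ZMod p =>
      (⟨⟨x.1, incl x.2.1, 0, x.2.2.1, x.2.2.2⟩, by simp [inertia]⟩ : inertia p)) := by
    constructor
    · rintro ⟨t, k, c, d⟩ ⟨t', k', c', d'⟩ h
      have h := congrArg Subtype.val h
      simpa [incl_injective.eq_iff] using h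
    · rintro ⟨⟨t, a, b, c, d⟩, ha, hb⟩
      obtain ⟨k, rfl⟩ := exists_incl_of_red_eq_zero ha
      exact ⟨(t, k, c, d), Subtype.ext (by ext <;> simp [show b = 0 from hb])⟩
  have hcard : Nat.card (inertia p) = p ^ 4 := by
    rw [← Nat.card_congr (Equiv.ofBijective _ hbij)]
    simp only [Nat.card_prod, Nat.card_zmod]
    ring
  have h := (inertia p).card_mul_index
  rw [hcard, card_eq] at h
  exact Nat.eq_of_mul_eq_mul_left (pow_pos hp.out.pos 4) (h.trans (pow_add p 4 2))

variable {V : Type} [AddCommGroup V] [Module ℂ V] {ρ : Representation ℂ (CubicExt p) V}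

lemma eq_cen_pow (k : ZMod p) : cen k = cen 1 ^ k.val := by
  rw [← cen_natCast, ZMod.natCast_zmod_val]

/-- The dimension of an irreducible representation that is trivial on the centre. -/
theorem finrank_of_cen_eq_one [FiniteDimensional ℂ V] (hρ : ρ.IsIrreducible)
    (hz : ρ (cen 1) = 1) : finrank ℂ V = 1 ∨ finrank ℂ V = p := by
  have := hρ.nontrivial
  have hcen : ∀ k, ρ (cen k) = 1 := fun k => by rw [eq_cen_pow, map_pow, hz, one_pow]
  have hcomm : ∀ x ∈ extra p, ∀ y ∈ extra p, ρ x * ρ y = ρ y * ρ x := by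
    intro x hx y hy
    rw [← map_mul, mul_eq_cen_mul hx hy, map_mul, hcen, one_mul, map_mul]
  obtain ⟨v, hv, χ', hχ'⟩ := Module.End.exists_common_eigenvector (ι := extra p) _ V
    (fun x => ρ x) (fun x y => hcomm x x.2 y y.2) rfl
  have hex : ∀ x, ∃ c : ℂ, x ∈ extra p → ρ x v = c • v := fun x => by
    by_cases hx : x ∈ extra p
    · exact ⟨χ' ⟨x, hx⟩, fun _ => hχ' ⟨x, hx⟩⟩
    · exact ⟨0, fun h => absurd h hx⟩
  choose χ hχ using hex
  have hcancel : ∀ c d : ℂ, c • v = d • v → c = d := fun c d h => by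
    have : (c - d) • v = 0 := by rw [sub_smul, h, sub_self]
    exact sub_eq_zero.1 ((smul_eq_zero.1 this).resolve_right hv)
  have hconj : ∀ g a, a ∈ extra p → g⁻¹ * a * g ∈ extra p := fun g a ha => by
    simpa using (inferInstance : (extra p).Normal).conj_mem a ha g⁻¹
  let T : Subgroup (CubicExt p) :=
    { carrier := {g | ∀ a ∈ extra p, χ (g⁻¹ * a * g) = χ a}
      one_mem' := by simp
      mul_mem' := by
        intro g h hg hh a ha
        rw [← hg a ha, ← hh _ (hconj g a ha)]
        simp [mul_assoc]
      inv_mem' := by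
        intro g hg a ha
        rw [← hg _ (hconj g⁻¹ a ha)]
        simp [mul_assoc] }
  have hGT : extra p ≤ T := by
    intro g hg a ha
    apply hcancel
    rw [← hχ _ (hconj g a ha), ← hχ a ha, map_mul, hcomm _ (mul_mem (inv_mem hg) ha) _ hg,
      ← map_mul, mul_inv_cancel_left]
  have hcoatom : IsCoatom (extra p) :=
    Subgroup.isCoatom_of_index_prime (by rw [index_extra]; exact hp.out)
  rcases hcoatom.le_iff.1 hGT with hT | hT
  · left
    let W : Submodule ℂ V := ⨅ a : extra p, Module.End.eigenspace (ρ a) (χ a)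
    have hW : ∀ w, w ∈ W ↔ ∀ a ∈ extra p, ρ a w = χ a • w := by
      intro w
      simp [W, Submodule.mem_iInf]
    have hWtop : W = ⊤ := by
      refine hρ.eq_top_of_invariant W (fun g w hw => ?_) hv ((hW v).2 hχ)
      rw [hW] at hw ⊢
      intro a ha
      have hg : χ (g⁻¹ * a * g) = χ a := (hT ▸ Subgroup.mem_top g : g ∈ T) a ha
      have h := congrArg (ρ g) (hw _ (hconj g a ha))
      rw [hg, map_smul, ← Module.End.mul_apply, ← map_mul] at h
      rw [← h, ← Module.End.mul_apply, ← map_mul]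
      congr 2
      group
    obtain ⟨l, hl⟩ := Module.End.exists_eigenvalue (ρ ⟨1, 0, 0, 0, 0⟩)
    obtain ⟨u, hu⟩ := hl.exists_hasEigenvector
    have hscalar : ∀ g, ∃ c : ℂ, ρ g u = c • u := by
      intro g
      refine ⟨l ^ g.t.val * χ ⟨0, g.a, g.b, g.c, g.d⟩, ?_⟩
      have hpow : (⟨g.t, 0, 0, 0, 0⟩ : CubicExt p) = ⟨1, 0, 0, 0, 0⟩ ^ g.t.val := by
        rw [mk_t_pow, ZMod.natCast_zmod_val]
      conv_lhs => rw [eq_mul_mk_t g, map_mul, hpow, map_pow, Module.End.mul_apply, hu.pow_apply,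
        map_smul, (hW u).1 (hWtop ▸ Submodule.mem_top) _ rfl, smul_smul]
    choose θ hθ using hscalar
    rw [hρ.finrank_eq_index ⊥ ⊤ bot_le θ hu.2 (fun s _ => hθ s) (fun g hg => absurd trivial hg),
      Subgroup.index_top]
  · right
    rw [hρ.finrank_eq_index (extra p) (extra p) le_rfl χ hv hχ ?_, index_extra]
    intro g hg
    rw [← hT] at hg
    by_contra! h
    exact hg h

/-- Conjugates of elements of `abel p`. -/
lemma conj_mk (g : CubicExt p) (c d : ZMod p) :
    g⁻¹ * ⟨0, 0, 0, c, d⟩ * g =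
      cen (2 * (3 * c * g.b - d * red g.a)) * ⟨0, 0, 0, c, d - 3 * g.t * c⟩ := by
  rw [mul_assoc, inv_mul_eq_iff_eq_mul, cen_mul]
  ext
  · simp
  · have h : cocycle ⟨0, 0, 0, c, d⟩ g = 2 * (3 * c * g.b - d * red g.a) +
        cocycle g ⟨0, incl (2 * (3 * c * g.b - d * red g.a)) + 0, 0, c, d - 3 * g.t * c⟩ := by
      simp [cocycle, actB, actC, actD]
      ring
    simp only [mul_a, h, map_add]
    ring
  all_goals simp [actB, actC, actD, add_comm]

lemma pow_prime_eq_one {x : CubicExt p} (hx : x ∈ extra p) (ha : red x.a = 0) : x ^ p = 1 := by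
  obtain ⟨k, hk⟩ := exists_incl_of_red_eq_zero ha
  rw [pow_of_mem_extra hx, hk]
  have h : (p : ZMod (p ^ 2)) * incl k = 0 := by
    rw [← nsmul_eq_mul, ← map_nsmul, nsmul_eq_mul, CharP.cast_eq_zero, zero_mul, map_zero]
  ext <;> simp [h]

/-- The dimension of an irreducible representation that is nontrivial on the centre. -/
theorem finrank_of_cen_ne_one [FiniteDimensional ℂ V] (hp5 : 5 ≤ p) (hρ : ρ.IsIrreducible)
    (hz : ρ (cen 1) ≠ 1) : finrank ℂ V = p ^ 2 := by
  have := hρ.nontrivial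
  have h2 := two_ne_zero_zmod hp5
  have h3 := three_ne_zero_zmod hp5
  have hinj : ∀ g, Function.Injective (ρ g) := fun g x y h => by
    simpa [← Module.End.mul_apply, ← map_mul] using congrArg (ρ g⁻¹) h
  obtain ⟨m, hm⟩ := Module.End.exists_eigenvalue (ρ (cen 1))
  obtain ⟨u, hu⟩ := hm.exists_hasEigenvector
  have htop : Module.End.eigenspace (ρ (cen 1)) m = ⊤ := by
    refine hρ.eq_top_of_invariant _ (fun g w hw => ?_) hu.2 hu.1
    rw [Module.End.mem_eigenspace_iff] at hw ⊢
    rw [← Module.End.mul_apply, ← map_mul, cen_comm, map_mul, Module.End.mul_apply, hw, map_smul]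
  have hzm : ∀ w, ρ (cen 1) w = m • w := fun w =>
    Module.End.mem_eigenspace_iff.1 (htop ▸ Submodule.mem_top)
  let ψ : ZMod p → ℂ := fun k => m ^ k.val
  have hzpow : ∀ (n : ℕ) w, ρ (cen 1 ^ n) w = m ^ n • w := by
    intro n w
    induction n with
    | zero => simp
    | succ n ih => rw [pow_succ', map_mul, Module.End.mul_apply, ih, map_smul, hzm, smul_smul,
        pow_succ]
  have hψ : ∀ k w, ρ (cen k) w = ψ k • w := fun k w => by rw [eq_cen_pow, hzpow]
  have hmp : m ^ p = 1 := by
    have h := hzpow p u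
    rw [← cen_natCast, CharP.cast_eq_zero] at h
    rw [show (cen 0 : CubicExt p) = 1 by ext <;> simp [cen], map_one, Module.End.one_apply] at h
    have h' : (m ^ p - 1) • u = 0 := by rw [sub_smul, one_smul, ← h, sub_self]
    exact sub_eq_zero.1 ((smul_eq_zero.1 h').resolve_right hu.2)
  have hm1 : m ≠ 1 := fun h => hz (by ext w; simp [hzm, h])
  have hψp : ∀ k, ψ k ^ p = 1 := fun k => by
    rw [← pow_mul, mul_comm, pow_mul, hmp, one_pow]
  have hψ1 : ∀ k, k ≠ 0 → ψ k ≠ 1 := by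
    intro k hk h
    have hd := orderOf_dvd_of_pow_eq_one h
    rw [orderOf_eq_prime hmp hm1] at hd
    apply hk
    rw [← ZMod.natCast_zmod_val k, ZMod.natCast_eq_zero_iff]
    exact hd
  have hswap : ∀ x ∈ extra p, ∀ y ∈ extra p, ρ x * ρ y =
      ψ (2 * (red x.a * y.d - x.d * red y.a - 3 * x.b * y.c + 3 * x.c * y.b)) •
        (ρ y * ρ x) := by
    intro x hx y hy
    ext w
    rw [← map_mul, mul_eq_cen_mul hx hy, map_mul, Module.End.mul_apply, hψ, map_mul,
      LinearMap.smul_apply]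
  obtain ⟨w₁, -, hw₁, hdw₁⟩ := exists_fixed_of_commute_up_to_root hp.out (ρ ⟨0, 0, 0, 0, 1⟩)
    (ρ ⟨0, 1, 0, 0, 0⟩) (ψ (2 * -1)) (hψp _) (hψ1 _ (by simp [h2]))
    (by simpa using hswap ⟨0, 0, 0, 0, 1⟩ rfl ⟨0, 1, 0, 0, 0⟩ rfl)
    (by rw [← map_pow, pow_prime_eq_one rfl (map_zero _), map_one]) (hinj _) ⊤ top_ne_bot
    (fun _ _ => trivial) (fun _ _ => trivial)
  have hstable : ∀ b c : ZMod p, ∀ w ∈ Module.End.eigenspace (ρ ⟨0, 0, 0, 0, 1⟩) 1,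
      ρ ⟨0, 0, b, c, 0⟩ w ∈ Module.End.eigenspace (ρ ⟨0, 0, 0, 0, 1⟩) 1 := by
    intro b c w hw
    rw [Module.End.mem_eigenspace_iff] at hw ⊢
    have h : (⟨0, 0, 0, 0, 1⟩ : CubicExt p) * ⟨0, 0, b, c, 0⟩ =
        ⟨0, 0, b, c, 0⟩ * ⟨0, 0, 0, 0, 1⟩ := by
      ext <;> simp [cocycle, actB, actC, actD]
    rw [← Module.End.mul_apply, ← map_mul, h, map_mul, Module.End.mul_apply, hw, map_smul]
  obtain ⟨w₂, hdw₂, hw₂, hcw₂⟩ := exists_fixed_of_commute_up_to_root hp.out (ρ ⟨0, 0, 0, 1, 0⟩)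
    (ρ ⟨0, 0, 1, 0, 0⟩) (ψ (2 * 3)) (hψp _) (hψ1 _ (mul_ne_zero h2 h3))
    (by simpa using hswap ⟨0, 0, 0, 1, 0⟩ rfl ⟨0, 0, 1, 0, 0⟩ rfl)
    (by rw [← map_pow, pow_prime_eq_one rfl (map_zero _), map_one]) (hinj _) _
    ((Submodule.ne_bot_iff _).2
      ⟨w₁, Module.End.mem_eigenspace_iff.2 (by rw [hdw₁, one_smul]), hw₁⟩)
    (hstable _ _) (hstable _ _)
  rw [Module.End.mem_eigenspace_iff, one_smul] at hdw₂
  let W : Submodule ℂ V :=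
    ⨅ x : ZMod p × ZMod p, Module.End.eigenspace (ρ ⟨0, 0, 0, x.1, x.2⟩) 1
  have hW : ∀ w, w ∈ W ↔ ∀ c d, ρ ⟨0, 0, 0, c, d⟩ w = w := by
    intro w
    simp [W, Submodule.mem_iInf]
  have hw₂W : w₂ ∈ W := by
    rw [hW]
    intro c d
    have hfix : ∀ g, ρ g w₂ = w₂ → ∀ n : ℕ, ρ (g ^ n) w₂ = w₂ := by
      intro g hg n
      induction n with
      | zero => simp
      | succ n ih => rw [pow_succ, map_mul, Module.End.mul_apply, hg, ih]
    have h : (⟨0, 0, 0, c, d⟩ : CubicExt p) =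
        ⟨0, 0, 0, 1, 0⟩ ^ c.val * ⟨0, 0, 0, 0, 1⟩ ^ d.val := by
      rw [pow_of_mem_extra rfl, pow_of_mem_extra rfl]
      ext <;> simp [cocycle, actB, actC, actD]
    rw [h, map_mul, Module.End.mul_apply, hfix _ hdw₂, hfix _ hcw₂]
  have hτ : ∀ w ∈ W, ρ ⟨1, 0, 0, 0, 0⟩ w ∈ W := by
    intro w hw
    rw [hW] at hw ⊢
    intro c d
    have h := conj_mk (⟨1, 0, 0, 0, 0⟩ : CubicExt p) c d
    rw [mul_assoc, inv_mul_eq_iff_eq_mul] at h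
    rw [← Module.End.mul_apply, ← map_mul, h]
    simp [cen_mul, hw]
  have : Nontrivial W := Submodule.nontrivial_iff_ne_bot.2 ((Submodule.ne_bot_iff _).2
    ⟨w₂, hw₂W, hw₂⟩)
  obtain ⟨l, hl⟩ := Module.End.exists_eigenvalue ((ρ ⟨1, 0, 0, 0, 0⟩).restrict hτ)
  obtain ⟨⟨v, hvW⟩, hv⟩ := hl.exists_hasEigenvector
  have hv0 : v ≠ 0 := fun h => hv.2 (Subtype.ext h)
  have hτv : Module.End.HasEigenvector (ρ ⟨1, 0, 0, 0, 0⟩) l v :=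
    ⟨Module.End.mem_eigenspace_iff.2 (congrArg Subtype.val hv.apply_eq_smul), hv0⟩
  have hcen : ∀ k c d, ρ (cen k * ⟨0, 0, 0, c, d⟩) v = ψ k • v := fun k c d => by
    rw [map_mul, Module.End.mul_apply, (hW v).1 hvW, hψ]
  have hex : ∀ s, ∃ z : ℂ, s ∈ inertia p → ρ s v = z • v := by
    intro s
    by_cases hs : s ∈ inertia p
    · obtain ⟨k, hk⟩ := exists_incl_of_red_eq_zero hs.1
      refine ⟨l ^ s.t.val * ψ k, fun _ => ?_⟩
      have h : s = cen k * ⟨0, 0, 0, s.c, s.d⟩ * ⟨1, 0, 0, 0, 0⟩ ^ s.t.val := by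
        rw [mk_t_pow, ZMod.natCast_zmod_val, cen_mul]
        conv_lhs => rw [eq_mul_mk_t s, hk, hs.2]
        simp
      conv_lhs => rw [h, map_mul, Module.End.mul_apply, map_pow, hτv.pow_apply, map_smul, hcen,
        smul_smul]
    · exact ⟨0, fun h => absurd h hs⟩
  choose χ hχ using hex
  have hχcen : ∀ k c d, χ (cen k * ⟨0, 0, 0, c, d⟩) = ψ k := by
    intro k c d
    have h := hχ (cen k * ⟨0, 0, 0, c, d⟩) (by simp [cen_mul, inertia])
    rw [hcen] at h
    exact (smul_left_injective ℂ hv0 h).symm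
  have hχone : ∀ c d, χ ⟨0, 0, 0, c, d⟩ = 1 := by
    intro c d
    simpa [cen_mul, ψ] using hχcen 0 c d
  rw [hρ.finrank_eq_index (abel p) (inertia p) (fun _ hx => hx.2) χ hv0 hχ ?_, index_inertia]
  intro g hg
  by_cases ha : red g.a = 0
  · have hb : g.b ≠ 0 := fun hb => hg ⟨ha, hb⟩
    refine ⟨⟨0, 0, 0, 1, 0⟩, by simp [abel], ?_⟩
    rw [conj_mk, hχcen, hχone]
    exact hψ1 _ (by simp [h2, h3, hb])
  · refine ⟨⟨0, 0, 0, 0, 1⟩, by simp [abel], ?_⟩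
    rw [conj_mk, hχcen, hχone]
    exact hψ1 _ (by simp [h2, ha])

end CubicExt

section CharDegrees

open Module

lemma one_mem_charDegrees (G : Type) [Group G] [Finite G] : 1 ∈ charDegrees G := by
  have : (Representation.trivial ℂ G ℂ).IsIrreducible :=
    { exists_pair_ne := ⟨⊥, ⊤, fun h =>
        bot_ne_top (α := Submodule ℂ ℂ) (congrArg Subrepresentation.toSubmodule h)⟩
      eq_bot_or_eq_top := fun W => by
        rcases eq_bot_or_eq_top W.toSubmodule with h | h
        · exact Or.inl (Subrepresentation.toSubmodule_injective h)
        · exact Or.inr (Subrepresentation.toSubmodule_injective h) }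
  exact ⟨_, FDRep.simple_of_isIrreducible (Representation.trivial ℂ G ℂ), Module.finrank_self ℂ⟩

lemma finrank_mem_charDegrees {G U : Type} [Group G] [Finite G] [AddCommGroup U] [Module ℂ U]
    [FiniteDimensional ℂ U] {σ : Representation ℂ G U} (_ : σ.IsIrreducible) :
    finrank ℂ U ∈ charDegrees G :=
  ⟨_, FDRep.simple_of_isIrreducible σ, rfl⟩

/-- Every element of a finite group outside a normal subgroup `N` acts nontrivially on some
irreducible representation that is trivial on `N`. -/
lemma exists_isIrreducible_of_notMem {G : Type} [Group G] [Finite G] (N : Subgroup G) [N.Normal]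
    {g : G} (hg : g ∉ N) :
    ∃ (U : Type) (_ : AddCommGroup U) (_ : Module ℂ U) (_ : FiniteDimensional ℂ U)
      (σ : Representation ℂ G U), σ.IsIrreducible ∧ σ g ≠ 1 ∧ ∀ h ∈ N, σ h = 1 := by
  obtain ⟨U, i₁, i₂, i₃, σ, hσ, hσg, hσN⟩ := Representation.exists_isIrreducible_apply_ne_one g _ _
    (Representation.ofMulAction ℂ G (G ⧸ N)) rfl (fun h => hg (by
      have h' := LinearMap.congr_fun h (MonoidAlgebra.single ((1 : G) : G ⧸ N) 1)
      rw [Representation.ofMulAction_single, Module.End.one_apply] at h'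
      have h'' := MonoidAlgebra.single_left_injective one_ne_zero h'
      rw [MulAction.Quotient.smul_mk, smul_eq_mul, mul_one] at h''
      exact (QuotientGroup.eq_one_iff g).1 h''))
  refine ⟨U, i₁, i₂, i₃, σ, hσ, hσg, fun h hh => hσN h ?_⟩
  refine MonoidAlgebra.lhom_ext' fun q => ?_
  ext
  induction q using QuotientGroup.induction_on with
  | H x =>
    simp only [LinearMap.comp_apply, MonoidAlgebra.lsingle_apply, Module.End.one_apply,
      Representation.ofMulAction_single, MulAction.Quotient.smul_mk, smul_eq_mul,
      QuotientGroup.mk_mul, (QuotientGroup.eq_one_iff h).2 hh, one_mul]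

end CharDegrees

namespace CubicExt

open Module
open scoped commutatorElement

variable {p : ℕ} [hp : Fact p.Prime]

theorem charDegrees_eq (hp5 : 5 ≤ p) : charDegrees (CubicExt p) = {1, p, p ^ 2} := by
  ext d
  simp only [Set.mem_insert_iff, Set.mem_singleton_iff]
  constructor
  · rintro ⟨V, hV, rfl⟩
    have hirr := FDRep.isIrreducible_of_simple V
    by_cases hz : V.ρ (cen 1) = 1
    · rcases finrank_of_cen_eq_one hirr hz with h | h
      · exact Or.inl h
      · exact Or.inr (Or.inl h)
    · exact Or.inr (Or.inr (finrank_of_cen_ne_one hp5 hirr hz))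
  · rintro (rfl | rfl | rfl)
    · exact one_mem_charDegrees _
    · have : (central d).Normal := ⟨fun x hx g => by
        obtain ⟨k, rfl⟩ := exists_cen_of_mem_central hx
        rwa [← cen_comm, mul_inv_cancel_right]⟩
      have hκ : ⁅(⟨1, 0, 0, 0, 0⟩ : CubicExt d), ⟨0, 1, 0, 0, 0⟩⁆ ∉ central d := by
        simp [mem_central, commutatorElement_def, actB]
      obtain ⟨U, _, _, _, σ, hσ, hσκ, hσN⟩ := exists_isIrreducible_of_notMem (central d) hκ
      have hU := finrank_mem_charDegrees hσ
      rcases finrank_of_cen_eq_one hσ (hσN _ (cen_mem_central 1)) with h | h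
      · refine absurd ?_ hσκ
        have hcomm : ∀ X Y : Module.End ℂ U, X * Y = Y * X := by
          intro X Y
          obtain ⟨c, hc, -⟩ := LinearMap.existsUnique_eq_smul_id_of_finrank_eq_one h X
          ext u
          simp [hc]
        rw [commutatorElement_def, mul_assoc, map_mul, map_mul, hcomm (σ _) (σ _), ← map_mul,
          ← map_mul]
        simp
      · rwa [h] at hU
    · have h1 : (cen 1 : CubicExt p) ∉ (⊥ : Subgroup (CubicExt p)) := by
        rw [Subgroup.mem_bot, show (1 : CubicExt p) = cen 0 by ext <;> simp [cen]]
        exact fun h => one_ne_zero (cen_injective h)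
      obtain ⟨U, _, _, _, σ, hσ, hσz, -⟩ := exists_isIrreducible_of_notMem ⊥ h1
      rw [← finrank_of_cen_ne_one hp5 hσ hσz]
      exact finrank_mem_charDegrees hσ

end CubicExt

theorem exists_group_p6_dl_three_extraspecial_exponent_p_sq (p : ℕ)
    (hp : p.Prime) (hp5 : 5 ≤ p) :
    ∃ (P : Type) (_ : Group P) (_ : Finite P),
      Nat.card P = p ^ 6 ∧
      derivedSeries P 2 ≠ ⊥ ∧ derivedSeries P 3 = ⊥ ∧
      charDegrees P = {1, p, p ^ 2} ∧
      ∃ G : Subgroup P, G.Normal ∧ G.index = p ∧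
        IsExtraspecial p ↥G ∧ Nat.card ↥G = p ^ 5 ∧
        (∀ g ∈ G, g ^ p ^ 2 = 1) ∧ (∃ g ∈ G, orderOf g = p ^ 2) := by
  have : Fact p.Prime := ⟨hp⟩
  exact ⟨CubicExt p, inferInstance, inferInstance, CubicExt.card_eq,
    CubicExt.derivedSeries_two_ne_bot hp5, CubicExt.derivedSeries_three,
    CubicExt.charDegrees_eq hp5, CubicExt.extra p, inferInstance, CubicExt.index_extra,
    CubicExt.isExtraspecial_extra hp5, CubicExt.card_extra, fun g hg => CubicExt.pow_sq_eq_one hg,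
    CubicExt.exists_orderOf_eq_sq⟩
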